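/- arXiv:2201.12582 — 2 statements merged into one kernel-verified Lean document; each statement's English description precedes it below -/
import Mathlib

section
/- Let T be a tree with order p and diameter d ≥ 2, let f be a radio labelling of T, and let u_0, u_1, ..., u_{p-1} be the induced linear order of V(T). Then span(f) = (p-1)(d+1) - 2L(T) + L(u_0) + L(u_{p-1}) + σ(f). -/
open SimpleGraph Finset

open scoped Classical

namespace RadioPaper

variable {V : Type*} [Fintype V] [DecidableEq V]

/-- The diameter of a graph: the maximum distance between two vertices. -/
noncomputable def gdiam (G : SimpleGraph V) : ℕ :=
  Finset.univ.sup fun pr : V × V => G.dist pr.1 pr.2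

/-- A radio labelling of `G`: `|f u - f v| ≥ diam G + 1 - d(u,v)` for distinct `u, v`. -/
def IsRadioLabelling (G : SimpleGraph V) (f : V → ℕ) : Prop :=
  ∀ u v : V, u ≠ v → (gdiam G : ℤ) + 1 - (G.dist u v : ℤ) ≤ |(f u : ℤ) - (f v : ℤ)|

/-- The span of a labelling: the maximum difference between two labels. -/
noncomputable def span (f : V → ℕ) : ℕ :=
  Finset.univ.sup fun pr : V × V => f pr.1 - f pr.2

/-- The radio number of `G`: the minimum span of a radio labelling. -/
noncomputable def radioNumber (G : SimpleGraph V) : ℕ :=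
  sInf {s | ∃ f : V → ℕ, IsRadioLabelling G f ∧ span f = s}

/-- The weight of `G` from `v`. -/
noncomputable def weight (G : SimpleGraph V) (v : V) : ℕ := ∑ u : V, G.dist u v

/-- The set of weight centers: vertices of minimum weight. -/
noncomputable def wcenters (G : SimpleGraph V) : Finset V :=
  Finset.univ.filter fun v => ∀ u : V, weight G v ≤ weight G u

/-- `ε(T) = 2 - |W(T)|`. -/
noncomputable def eps (G : SimpleGraph V) : ℕ := 2 - (wcenters G).card

/-- The level of a vertex: its minimum distance to a weight center. -/
noncomputable def level (G : SimpleGraph V) (u : V) : ℕ :=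
  sInf {n | ∃ x ∈ wcenters G, G.dist u x = n}

/-- The total level of `G`. -/
noncomputable def totalLevel (G : SimpleGraph V) : ℕ := ∑ u : V, level G u

/-- `T` is a two-branch tree: removing the weight centers leaves exactly two components. -/
def TwoBranch (G : SimpleGraph V) : Prop :=
  Nat.card (SimpleGraph.induce {v : V | v ∉ wcenters G} G).ConnectedComponent = 2

/-- The set of remote vertices `S(T)`. -/
noncomputable def remote (G : SimpleGraph V) : Finset V :=
  if (wcenters G).card = 1 then Finset.univ.filter fun u => (gdiam G + 1) / 2 ≤ level G u
  else Finset.univ.filter fun u => gdiam G / 2 ≤ level G u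

/-- `ξ(T)`. -/
noncomputable def xi (G : SimpleGraph V) : ℕ :=
  if (wcenters G).card = 1 then (remote G).card / 2 else (remote G).card - 2

/-- `u` and `v` lie in different branches: the path between them traverses exactly one
weight center. -/
def DiffBranches (G : SimpleGraph V) (u v : V) : Prop :=
  ∀ p : G.Path u v, (p.1.support.filter fun x => decide (x ∈ wcenters G)).length = 1

/-- `u` and `v` lie in opposite branches: the path between them traverses two weight centers. -/
def OppBranches (G : SimpleGraph V) (u v : V) : Prop :=
  ∀ p : G.Path u v, (p.1.support.filter fun x => decide (x ∈ wcenters G)).length = 2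

/-- `u` and `v` lie in the same branch of `T - W(T)`. -/
def SameBranch (G : SimpleGraph V) (u v : V) : Prop :=
  ∃ (hu : u ∉ wcenters G) (hv : v ∉ wcenters G),
    (SimpleGraph.induce {x : V | x ∉ wcenters G} G).Reachable ⟨u, hu⟩ ⟨v, hv⟩

/-- `x` is an ancestor of `v`: `x` lies on the path joining a weight center and `v`. -/
def IsAncestor (G : SimpleGraph V) (x v : V) : Prop :=
  ∃ w ∈ wcenters G, ∀ p : G.Path w v, x ∈ p.1.support

/-- `φ(u,v)`: the maximum level of a common ancestor of `u` and `v`. -/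
noncomputable def phi (G : SimpleGraph V) (u v : V) : ℕ :=
  sSup {n | ∃ x : V, IsAncestor G x u ∧ IsAncestor G x v ∧ level G x = n}

/-- `δ(u,v)`. -/
noncomputable def deltaWC (G : SimpleGraph V) (u v : V) : ℕ :=
  if (wcenters G).card = 2 ∧ ∀ p : G.Path u v, ∀ w ∈ wcenters G, w ∈ p.1.support then 1 else 0

/-- `u` enumerates the vertices of `G` in strictly increasing order of labels under `f`. -/
def IsInducedOrder (G : SimpleGraph V) (f : V → ℕ) (u : ℕ → V) : Prop :=
  (∀ v : V, ∃! i : ℕ, i < Fintype.card V ∧ u i = v) ∧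
  ∀ i j : ℕ, i < j → j < Fintype.card V → f (u i) < f (u j)

/-- `J_f(u_t, u_{t+1})`. -/
noncomputable def Jstep (G : SimpleGraph V) (f : V → ℕ) (u : ℕ → V) (t : ℕ) : ℤ :=
  ((f (u (t+1)) : ℤ) - (f (u t) : ℤ)) + (G.dist (u t) (u (t+1)) : ℤ) - ((gdiam G : ℤ) + 1)

/-- `J_f(u_i, …, u_j)`. -/
noncomputable def Jseg (G : SimpleGraph V) (f : V → ℕ) (u : ℕ → V) (i j : ℕ) : ℤ :=
  ∑ t ∈ Finset.Ico i j, Jstep G f u t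

/-- `σ(f)`. -/
noncomputable def sigmaF (G : SimpleGraph V) (f : V → ℕ) (u : ℕ → V) : ℤ :=
  ∑ t ∈ Finset.range (Fintype.card V - 1),
    (Jstep G f u t + 2 * (phi G (u t) (u (t+1)) : ℤ) - (deltaWC G (u t) (u (t+1)) : ℤ))

/-- Consecutive vertices in the order are in different branches when `|W(T)| = 1`
and in opposite branches when `|W(T)| = 2`. -/
def BranchStep (G : SimpleGraph V) (u v : V) : Prop :=
  ((wcenters G).card = 1 → DiffBranches G u v) ∧
  ((wcenters G).card = 2 → OppBranches G u v)

/-- `f ∈ F`: every pair of consecutive vertices of the induced order is in different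
branches when `|W(T)| = 1` and in opposite branches when `|W(T)| = 2`. -/
def MemF (G : SimpleGraph V) (f : V → ℕ) (u : ℕ → V) : Prop :=
  ∀ i : ℕ, i + 1 < Fintype.card V → BranchStep G (u i) (u (i+1))

/-- `u_i, u_{i+1}` is a bad pair. -/
def BadPair (G : SimpleGraph V) (u : ℕ → V) (i : ℕ) : Prop :=
  i + 1 < Fintype.card V ∧ u i ∉ wcenters G ∧ u (i+1) ∉ wcenters G ∧
    SameBranch G (u i) (u (i+1))

/-- `X_f`: the set of vertices in at least one bad pair. -/
noncomputable def Xf (G : SimpleGraph V) (u : ℕ → V) : Finset V :=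
  Finset.univ.filter fun v => ∃ i : ℕ, BadPair G u i ∧ (v = u i ∨ v = u (i+1))

/-- `[i, j]` is a maximal run of positions (within `[0, p-1]`) satisfying `P`. -/
def IsMaxRun (p : ℕ) (P : ℕ → Prop) (i j : ℕ) : Prop :=
  i ≤ j ∧ j < p ∧ (∀ t, i ≤ t → t ≤ j → P t) ∧ (i = 0 ∨ ¬P (i - 1)) ∧ (j = p - 1 ∨ ¬P (j + 1))

/-- The number of maximal runs of `P` having odd length. -/
noncomputable def oddRunCount (p : ℕ) (P : ℕ → Prop) : ℕ :=
  ((Finset.range p ×ˢ Finset.range p).filter fun ij : ℕ × ℕ =>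
    IsMaxRun p P ij.1 ij.2 ∧ Odd (ij.2 - ij.1 + 1)).card

/-- The linear order `u` is feasible. -/
def Feasible (G : SimpleGraph V) (u : ℕ → V) : Prop :=
  (Even (remote G).card →
    oddRunCount (Fintype.card V) (fun t => u t ∈ remote G) = 0) ∧
  (Odd (remote G).card →
    oddRunCount (Fintype.card V) (fun t => u t ∈ remote G) ≤ 1)

/-- Position `t` is immediately before or after a weight center in the order `u`. -/
def NearWC (G : SimpleGraph V) (u : ℕ → V) (t : ℕ) : Prop :=
  (t + 1 < Fintype.card V ∧ u (t+1) ∈ wcenters G) ∨ (1 ≤ t ∧ u (t-1) ∈ wcenters G)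

/-- Position `t` holds a remote vertex not immediately before or after a weight center. -/
def RemainingRemote (G : SimpleGraph V) (u : ℕ → V) (t : ℕ) : Prop :=
  t < Fintype.card V ∧ u t ∈ remote G ∧ ¬NearWC G u t

/-- The linear order `u` is admissible. -/
def Admissible (G : SimpleGraph V) (u : ℕ → V) : Prop :=
  (∀ t : ℕ, t < Fintype.card V → u t ∈ wcenters G →
    (1 ≤ t → u (t-1) ∈ remote G) ∧ (t + 1 < Fintype.card V → u (t+1) ∈ remote G)) ∧
  (Even ((Finset.range (Fintype.card V)).filter fun t => RemainingRemote G u t).card →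
    oddRunCount (Fintype.card V) (RemainingRemote G u) = 0) ∧
  (Odd ((Finset.range (Fintype.card V)).filter fun t => RemainingRemote G u t).card →
    oddRunCount (Fintype.card V) (RemainingRemote G u) ≤ 1)

/-- Condition (a) of Theorem `thm:lower` on the linear order `u`. -/
def OrderCondA (G : SimpleGraph V) (u : ℕ → V) : Prop :=
  ((wcenters G).card = 1 →
    (Odd (remote G).card →
      level G (u 0) + level G (u (Fintype.card V - 1)) = 1 ∧ Admissible G u) ∧
    (Even (remote G).card →
      (level G (u 0) + level G (u (Fintype.card V - 1)) = 1 ∧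
        (Feasible G u ∨ Admissible G u)) ∨
      (level G (u 0) + level G (u (Fintype.card V - 1)) = 2 ∧ Admissible G u))) ∧
  ((wcenters G).card = 2 →
    Admissible G u ∧
    ((remote G).card = 1 ∨ (remote G).card = 2 →
      level G (u 0) + level G (u (Fintype.card V - 1)) = 0) ∧
    (3 ≤ (remote G).card → Odd (remote G).card →
      level G (u 0) + level G (u (Fintype.card V - 1)) = 1) ∧
    (4 ≤ (remote G).card → Even (remote G).card →
      level G (u 0) + level G (u (Fintype.card V - 1)) = 0 ∨
      level G (u 0) + level G (u (Fintype.card V - 1)) = 2))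

/-- Condition (b) of Theorem `thm:lower`: the distance inequality. -/
def OrderCondB (G : SimpleGraph V) (u : ℕ → V) (a : ℕ → ℕ) : Prop :=
  ∀ i j : ℕ, i < j → j ≤ Fintype.card V - 1 →
    (∑ t ∈ Finset.Ico i j,
      ((level G (u t) : ℤ) + (level G (u (t+1)) : ℤ) - (a t : ℤ)
        - ((gdiam G : ℤ) + (eps G : ℤ))))
      + ((gdiam G : ℤ) + 1) ≤ (G.dist (u i) (u j) : ℤ)

/-- The sequence `a_0, …, a_{p-2}` determined by the order `u` via `(eq:a0)`–`(eq:seq)`. -/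
def SeqA (G : SimpleGraph V) (u : ℕ → V) (a : ℕ → ℕ) : Prop :=
  a 0 = 0 ∧
  ∀ t : ℕ, 1 ≤ t → t ≤ Fintype.card V - 2 →
    a (t-1) + a t =
      if u t ∈ remote G ∧ u (t-1) ∉ wcenters G ∧ u (t+1) ∉ wcenters G
      then (wcenters G).card else 0

/-- The spine index set of the caterpillar `C(n,k)`. -/
def spineSet (n : ℕ) : Finset ℕ :=
  if n % 2 = 1 then {1, (n-1)/2, (n+3)/2, n} else {1, (n-2)/2, (n+4)/2, n}

/-- `G` is (isomorphic to) the caterpillar `C(n,k)`. -/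
def IsCaterpillarC (G : SimpleGraph V) (n k : ℕ) : Prop :=
  G.IsTree ∧
  ∃ v : ℕ → V,
    (∀ i j : ℕ, 1 ≤ i → i ≤ n → 1 ≤ j → j ≤ n → v i = v j → i = j) ∧
    (∀ i : ℕ, 1 ≤ i → i < n → G.Adj (v i) (v (i+1))) ∧
    (∀ x : V, (∃ i : ℕ, 1 ≤ i ∧ i ≤ n ∧ v i = x) ∨ (G.neighborSet x).ncard = 1) ∧
    (∀ i : ℕ, 1 ≤ i → i ≤ n →
      {x ∈ G.neighborSet (v i) | (G.neighborSet x).ncard = 1}.ncard =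
        if i ∈ spineSet n then k else 0)

/-- `G` is (isomorphic to) the level-wise regular tree `T^z_{m_0, …, m_{h-1}}`:
a tree with a center `C` of `z` vertices (adjacent when `z = 2`), height `h`,
in which every vertex at distance `i < h` from `C` has degree `m i` and every
vertex at distance `h` from `C` is a leaf. -/
def IsLevelwiseRegular (G : SimpleGraph V) (z h : ℕ) (m : ℕ → ℕ) : Prop :=
  G.IsTree ∧
  ∃ (C : Finset V) (dC : V → ℕ),
    C.card = z ∧
    (∀ c ∈ C, ∀ c' ∈ C, c ≠ c' → G.Adj c c') ∧
    (∀ x : V, IsLeast {n | ∃ c ∈ C, G.dist x c = n} (dC x)) ∧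
    (∀ x : V, dC x ≤ h) ∧
    (∀ x : V, dC x = h → (G.neighborSet x).ncard = 1) ∧
    (∀ x : V, dC x < h → (G.neighborSet x).ncard = m (dC x))

/-- In a tree, every path is a geodesic. -/
lemma length_eq_dist_of_isPath {G : SimpleGraph V} (hT : G.IsTree) {u v : V}
    {p : G.Walk u v} (hp : p.IsPath) : p.length = G.dist u v := by
  obtain ⟨q, hq, hl⟩ := (hT.connected.preconnected u v).exists_path_of_dist
  have h := (hT.isAcyclic.subsingleton_path _ _).elim ⟨p, hp⟩ ⟨q, hq⟩
  rw [Subtype.mk.injEq] at h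
  rw [h, hl]

lemma mem_support_iff_dist {G : SimpleGraph V} (hT : G.IsTree) {u v x : V}
    {p : G.Walk u v} (hp : p.IsPath) :
    x ∈ p.support ↔ G.dist u x + G.dist x v = G.dist u v := by
  constructor
  · intro hx
    have h := congrArg Walk.length (p.take_spec hx)
    rw [Walk.length_append, length_eq_dist_of_isPath hT (hp.takeUntil hx),
      length_eq_dist_of_isPath hT (hp.dropUntil hx), length_eq_dist_of_isPath hT hp] at h
    exact h
  · intro h
    obtain ⟨q, hq, hql⟩ := (hT.connected.preconnected u x).exists_path_of_dist
    obtain ⟨r, hr, hrl⟩ := (hT.connected.preconnected x v).exists_path_of_dist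
    have hqr : (q.append r).IsPath := by
      apply Walk.isPath_of_length_eq_dist
      rw [Walk.length_append, hql, hrl, h]
    have he := (hT.isAcyclic.subsingleton_path _ _).elim ⟨p, hp⟩ ⟨q.append r, hqr⟩
    rw [Subtype.mk.injEq] at he
    rw [he, Walk.mem_support_append_iff]
    exact Or.inl q.end_mem_support

/-- If two paths of a tree meet only at their common endpoint, distances add up. -/
lemma dist_eq_add_of_support_inter {G : SimpleGraph V} (hT : G.IsTree) {w m v : V}
    {r : G.Walk w m} {q : G.Walk m v} (hr : r.IsPath) (hq : q.IsPath)
    (h : ∀ x ∈ r.support, x ∈ q.support → x = m) :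
    G.dist w v = G.dist w m + G.dist m v := by
  have hp : (r.append q).IsPath := by
    rw [Walk.isPath_def, Walk.support_append, List.nodup_append]
    refine ⟨hr.support_nodup, hq.support_nodup.tail, ?_⟩
    rintro x hx y hy rfl
    have hxm := h x hx (List.mem_of_mem_tail hy)
    subst hxm
    have hn := hq.support_nodup
    rw [← Walk.cons_tail_support, List.nodup_cons] at hn
    exact hn.1 hy
  rw [← length_eq_dist_of_isPath hT hp, Walk.length_append,
    length_eq_dist_of_isPath hT hr, length_eq_dist_of_isPath hT hq]

/-- Any three vertices of a tree have a median. -/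
lemma exists_median {G : SimpleGraph V} (hT : G.IsTree) (w u v : V) :
    ∃ m, G.dist w u = G.dist w m + G.dist m u ∧ G.dist w v = G.dist w m + G.dist m v ∧
      G.dist u v = G.dist u m + G.dist m v := by
  obtain ⟨p, hp, -⟩ := (hT.connected.preconnected u v).exists_path_of_dist
  obtain ⟨m, hm, hmin⟩ := p.support.toFinset.exists_min_image (fun x => G.dist w x)
    ⟨u, by simp⟩
  simp only [List.mem_toFinset] at hm hmin
  obtain ⟨r, hr, -⟩ := (hT.connected.preconnected w m).exists_path_of_dist
  have key : ∀ x ∈ r.support, x ∈ p.support → x = m := by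
    intro x hx hxp
    have h1 := (mem_support_iff_dist hT hr).1 hx
    have h2 := hmin x hxp
    exact (hT.connected.dist_eq_zero_iff).1 (by omega)
  refine ⟨m, ?_, ?_, ?_⟩
  · refine dist_eq_add_of_support_inter hT hr (hp.takeUntil hm).reverse fun x hx hx' => ?_
    rw [Walk.support_reverse, List.mem_reverse] at hx'
    exact key x hx (p.support_takeUntil_subset_support hm hx')
  · exact dist_eq_add_of_support_inter hT hr (hp.dropUntil hm) fun x hx hx' =>
      key x hx (p.support_dropUntil_subset_support hm hx')
  · exact ((mem_support_iff_dist hT hp).1 hm).symm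

lemma dist_adj_cases {G : SimpleGraph V} (hT : G.IsTree) {a b : V} (hab : G.Adj a b) (u : V) :
    G.dist u b = G.dist u a + 1 ∨ G.dist u a = G.dist u b + 1 := by
  obtain ⟨m, h1, h2, h3⟩ := exists_median hT u a b
  rw [G.dist_comm (u := a) (v := m), dist_eq_one_iff_adj.2 hab] at h3
  omega

/-- A vertex of a tree has at most one neighbour closer to a given vertex. -/
lemma two_mul_dist_le {G : SimpleGraph V} (hT : G.IsTree) {x y z : V} (hxy : G.Adj x y)
    (hzy : G.Adj z y) (hxz : x ≠ z) (u : V) :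
    2 * G.dist u y ≤ G.dist u x + G.dist u z := by
  rcases dist_adj_cases hT hxy u with hx | hx <;> rcases dist_adj_cases hT hzy u with hz | hz <;>
    try omega
  exfalso
  obtain ⟨p, -, hpl⟩ := (hT.connected.preconnected u x).exists_path_of_dist
  obtain ⟨q, -, hql⟩ := (hT.connected.preconnected u z).exists_path_of_dist
  have hp : (p.concat hxy).IsPath := by
    apply Walk.isPath_of_length_eq_dist
    rw [Walk.length_concat, hpl, hx]
  have hq : (q.concat hzy).IsPath := by
    apply Walk.isPath_of_length_eq_dist
    rw [Walk.length_concat, hql, hz]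
  have h := (hT.isAcyclic.subsingleton_path _ _).elim ⟨_, hp⟩ ⟨_, hq⟩
  rw [Subtype.mk.injEq] at h
  have h' := congrArg Walk.penultimate h
  rw [Walk.penultimate_concat, Walk.penultimate_concat] at h'
  exact hxz h'

/-- The weight function of a tree is strictly convex along paths. -/
lemma two_mul_weight_lt {G : SimpleGraph V} (hT : G.IsTree) {x y z : V} (hxy : G.Adj x y)
    (hzy : G.Adj z y) (hxz : x ≠ z) :
    2 * weight G y < weight G x + weight G z := by
  unfold weight
  rw [Finset.mul_sum, ← Finset.sum_add_distrib]
  refine Finset.sum_lt_sum (fun u _ => ?_) ⟨y, Finset.mem_univ _, ?_⟩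
  · exact two_mul_dist_le hT hxy hzy hxz u
  · rw [dist_eq_one_iff_adj.2 hxy.symm, dist_eq_one_iff_adj.2 hzy.symm, dist_self]
    norm_num

lemma mem_wcenters {G : SimpleGraph V} {v : V} :
    v ∈ wcenters G ↔ ∀ u, weight G v ≤ weight G u := by
  simp [wcenters]

lemma wcenters_nonempty {G : SimpleGraph V} (hT : G.IsTree) : (wcenters G).Nonempty := by
  have := hT.connected.nonempty
  obtain ⟨v, -, hv⟩ := Finset.univ.exists_min_image (weight G) Finset.univ_nonempty
  exact ⟨v, mem_wcenters.2 fun u => hv u (Finset.mem_univ _)⟩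

/-- Distinct weight centers of a tree are adjacent. -/
lemma adj_of_mem_wcenters {G : SimpleGraph V} (hT : G.IsTree) {a b : V}
    (ha : a ∈ wcenters G) (hb : b ∈ wcenters G) (hab : a ≠ b) : G.Adj a b := by
  obtain ⟨p, hp, -⟩ := (hT.connected.preconnected a b).exists_path_of_dist
  by_contra hn
  have hlen : 2 ≤ p.length := by
    have h0 : p.length ≠ 0 := fun h => hab (Walk.eq_of_length_eq_zero h)
    have h1 : p.length ≠ 1 := fun h => hn (Walk.adj_of_length_eq_one h)
    omega
  have hstep : ∀ i, i + 2 ≤ p.length →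
      weight G (p.getVert (i + 1)) < weight G (p.getVert (i + 2)) := by
    have hconv : ∀ i, i + 2 ≤ p.length → 2 * weight G (p.getVert (i + 1)) <
        weight G (p.getVert i) + weight G (p.getVert (i + 2)) := by
      intro i hi
      refine two_mul_weight_lt hT (p.adj_getVert_succ (by omega))
        (p.adj_getVert_succ (i := i + 1) (by omega)).symm fun h => ?_
      have := hp.getVert_injOn (by simp only [Set.mem_ofPred_eq]; omega)
        (by simp only [Set.mem_ofPred_eq]; omega) h
      omega
    intro i
    induction i with
    | zero =>
      intro hi
      have h1 := hconv 0 hi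
      have h2 := mem_wcenters.1 ha (p.getVert (0 + 1))
      rw [Walk.getVert_zero] at h1
      omega
    | succ i ih =>
      intro hi
      have h1 := hconv (i + 1) hi
      have h2 := ih (by omega)
      rw [show i + 1 + 1 = i + 2 from rfl] at *
      omega
  have h := hstep (p.length - 2) (by omega)
  rw [show p.length - 2 + 2 = p.length by omega, Walk.getVert_length] at h
  exact absurd (mem_wcenters.1 hb _) (not_le.2 h)

/-- A tree has at most two weight centers. -/
lemma eq_or_eq_of_mem_wcenters {G : SimpleGraph V} (hT : G.IsTree) {a b c : V}
    (ha : a ∈ wcenters G) (hb : b ∈ wcenters G) (hc : c ∈ wcenters G) (hab : a ≠ b) :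
    c = a ∨ c = b := by
  by_contra! h
  have h1 := two_mul_weight_lt hT (adj_of_mem_wcenters hT ha hb hab)
    (adj_of_mem_wcenters hT hc hb h.2) h.1.symm
  have h2 := mem_wcenters.1 ha b
  have h3 := mem_wcenters.1 hc b
  omega

lemma exists_level_eq {G : SimpleGraph V} (hT : G.IsTree) (u : V) :
    ∃ w ∈ wcenters G, G.dist u w = level G u := by
  obtain ⟨w, hw⟩ := wcenters_nonempty hT
  exact Nat.sInf_mem (s := {n | ∃ x ∈ wcenters G, G.dist u x = n}) ⟨_, w, hw, rfl⟩

lemma level_le {G : SimpleGraph V} {w : V} (hw : w ∈ wcenters G) (u : V) :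
    level G u ≤ G.dist u w :=
  Nat.sInf_le ⟨w, hw, rfl⟩

lemma level_le_dist_add {G : SimpleGraph V} (hT : G.IsTree) (u x : V) :
    level G u ≤ G.dist u x + level G x := by
  obtain ⟨w, hw, h⟩ := exists_level_eq hT x
  rw [← h]
  exact (level_le hw u).trans hT.connected.dist_triangle

lemma isAncestor_iff {G : SimpleGraph V} (hT : G.IsTree) {x v : V} :
    IsAncestor G x v ↔
      ∃ w ∈ wcenters G, G.dist w x + G.dist x v = G.dist w v := by
  refine exists_congr fun w => and_congr_right fun _ => ?_
  constructor
  · intro h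
    obtain ⟨p, hp, -⟩ := (hT.connected.preconnected w v).exists_path_of_dist
    exact (mem_support_iff_dist hT hp).1 (h ⟨p, hp⟩)
  · exact fun h p => (mem_support_iff_dist hT p.2).2 h

lemma level_eq_of_isAncestor {G : SimpleGraph V} (hT : G.IsTree) {x u : V}
    (h : IsAncestor G x u) (hx : x ∉ wcenters G) : level G u = G.dist u x + level G x := by
  refine le_antisymm (level_le_dist_add hT u x) ?_
  obtain ⟨w, hw, hd⟩ := (isAncestor_iff hT).1 h
  obtain ⟨c, hc, hcu⟩ := exists_level_eq hT u
  suffices G.dist c x + G.dist x u = G.dist c u by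
    have := level_le hc x
    rw [G.dist_comm (u := c) (v := x), G.dist_comm (u := x) (v := u),
      G.dist_comm (u := c) (v := u)] at *
    omega
  by_cases hwc : w = c
  · rw [← hwc, hd]
  have hadj := adj_of_mem_wcenters hT hw hc hwc
  obtain ⟨p, hp, hpl⟩ := (hT.connected.preconnected c u).exists_path_of_dist
  have hlen : G.dist w u = G.dist c u + 1 := by
    have h1 := level_le hw u
    have h2 := dist_adj_cases hT hadj u
    rw [G.dist_comm (u := w), G.dist_comm (u := c)]
    omega
  have hq : (Walk.cons hadj p).IsPath := by
    apply Walk.isPath_of_length_eq_dist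
    rw [Walk.length_cons, hpl, hlen]
  have hm := (mem_support_iff_dist hT hq).2 hd
  rw [Walk.support_cons, List.mem_cons] at hm
  rcases hm with rfl | hm
  · exact absurd hw hx
  · exact (mem_support_iff_dist hT hp).1 hm

lemma dist_add_two_mul_level_le {G : SimpleGraph V} (hT : G.IsTree) {x u v : V}
    (hu : IsAncestor G x u) (hv : IsAncestor G x v) (hx : x ∉ wcenters G) :
    G.dist u v + 2 * level G x ≤ level G u + level G v := by
  have h1 := level_eq_of_isAncestor hT hu hx
  have h2 := level_eq_of_isAncestor hT hv hx
  have h3 := hT.connected.dist_triangle (u := u) (v := x) (w := v)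
  rw [G.dist_comm (u := x) (v := v)] at h3
  omega

lemma level_of_mem_wcenters {G : SimpleGraph V} {x : V} (hx : x ∈ wcenters G) :
    level G x = 0 := by
  have h := level_le hx x
  rw [dist_self] at h
  omega

lemma phi_eq {G : SimpleGraph V} {u v x : V} (hu : IsAncestor G x u) (hv : IsAncestor G x v)
    (hmax : ∀ y, IsAncestor G y u → IsAncestor G y v → level G y ≤ level G x) :
    phi G u v = level G x := by
  refine IsGreatest.csSup_eq ⟨⟨x, hu, hv, rfl⟩, ?_⟩
  rintro _ ⟨y, hyu, hyv, rfl⟩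
  exact hmax y hyu hyv

lemma forall_mem_support_iff {G : SimpleGraph V} (hT : G.IsTree) {u v : V} :
    (∀ p : G.Path u v, ∀ w ∈ wcenters G, w ∈ p.1.support) ↔
      ∀ w ∈ wcenters G, G.dist u w + G.dist w v = G.dist u v := by
  obtain ⟨p, hp, -⟩ := (hT.connected.preconnected u v).exists_path_of_dist
  exact ⟨fun h w hw => (mem_support_iff_dist hT hp).1 (h ⟨p, hp⟩ w hw),
    fun h q w hw => (mem_support_iff_dist hT q.2).2 (h w hw)⟩

/-- The distance formula when a single weight center is nearest to both vertices. -/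
lemma dist_formula_of_common_center {G : SimpleGraph V} (hT : G.IsTree) {u v w : V}
    (hw : w ∈ wcenters G) (hu : G.dist u w = level G u) (hv : G.dist v w = level G v) :
    G.dist u v + 2 * phi G u v = level G u + level G v + deltaWC G u v := by
  obtain ⟨m, h1, h2, h3⟩ := exists_median hT w u v
  have hlm := level_le hw m
  have hum := level_le_dist_add hT u m
  have c1 := G.dist_comm (u := u) (v := w)
  have c2 := G.dist_comm (u := v) (v := w)
  have c3 := G.dist_comm (u := m) (v := w)
  have c4 := G.dist_comm (u := u) (v := m)
  have hphi : phi G u v = level G m := by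
    refine phi_eq ((isAncestor_iff hT).2 ⟨w, hw, h1.symm⟩)
      ((isAncestor_iff hT).2 ⟨w, hw, h2.symm⟩) fun y hyu hyv => ?_
    by_cases hy : y ∈ wcenters G
    · rw [level_of_mem_wcenters hy]
      exact Nat.zero_le _
    · have := dist_add_two_mul_level_le hT hyu hyv hy
      omega
  have hdelta : deltaWC G u v = 0 := by
    unfold deltaWC
    rw [if_neg]
    rintro ⟨hcard, hall⟩
    rw [forall_mem_support_iff hT] at hall
    obtain ⟨c, hc, hcw⟩ := Finset.exists_mem_ne (by omega : 1 < (wcenters G).card) w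
    have e1 := hall w hw
    have e2 := hall c hc
    have l1 := level_le hc u
    have l2 := level_le hc v
    have := dist_adj_cases hT (adj_of_mem_wcenters hT hc hw hcw) u
    have c5 := G.dist_comm (u := c) (v := v)
    omega
  rw [hphi, hdelta]
  omega

lemma dist_eq_of_adj_of_opposite {G : SimpleGraph V} (hT : G.IsTree) {u v a b : V}
    (hab : G.Adj a b) (hu : G.dist u b = G.dist u a + 1) (hv : G.dist v a = G.dist v b + 1) :
    G.dist u v = G.dist u a + G.dist v a := by
  obtain ⟨p, hp, hpl⟩ := (hT.connected.preconnected u a).exists_path_of_dist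
  obtain ⟨q, hq, hql⟩ := (hT.connected.preconnected b v).exists_path_of_dist
  have hq' : (Walk.cons hab q).IsPath := by
    apply Walk.isPath_of_length_eq_dist
    rw [Walk.length_cons, hql, G.dist_comm (u := a), hv, G.dist_comm (u := b)]
  rw [G.dist_comm (u := v) (v := a)]
  refine dist_eq_add_of_support_inter hT hp hq' fun x hx hx' => ?_
  rw [Walk.support_cons, List.mem_cons] at hx'
  rcases hx' with hx' | hx'
  · exact hx'
  exfalso
  have e1 := (mem_support_iff_dist hT hp).1 hx
  have e2 := (mem_support_iff_dist hT hq).1 hx'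
  have t1 := hT.connected.dist_triangle (u := u) (v := x) (w := b)
  have t2 := hT.connected.dist_triangle (u := v) (v := x) (w := a)
  have c1 := G.dist_comm (u := b) (v := x)
  have c2 := G.dist_comm (u := b) (v := v)
  have c3 := G.dist_comm (u := x) (v := v)
  omega

/-- The distance between two vertices of a tree in terms of levels, `φ` and `δ`. -/
lemma dist_formula {G : SimpleGraph V} (hT : G.IsTree) (u v : V) :
    G.dist u v + 2 * phi G u v = level G u + level G v + deltaWC G u v := by
  obtain ⟨a, ha, hau⟩ := exists_level_eq hT u
  obtain ⟨b, hb, hbv⟩ := exists_level_eq hT v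
  by_cases hva : G.dist v a = level G v
  · exact dist_formula_of_common_center hT ha hau hva
  by_cases hub : G.dist u b = level G u
  · exact dist_formula_of_common_center hT hb hub hbv
  have hne : a ≠ b := by
    rintro rfl
    exact hub hau
  have hab := adj_of_mem_wcenters hT ha hb hne
  have la := level_le ha v
  have lb := level_le hb u
  have hu : G.dist u b = G.dist u a + 1 := by
    have := dist_adj_cases hT hab u
    omega
  have hv : G.dist v a = G.dist v b + 1 := by
    have := dist_adj_cases hT hab v
    omega
  have hd := dist_eq_of_adj_of_opposite hT hab hu hv
  have hW : ∀ c ∈ wcenters G, c = a ∨ c = b := fun c hc =>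
    eq_or_eq_of_mem_wcenters hT ha hb hc hne
  have hdelta : deltaWC G u v = 1 := by
    unfold deltaWC
    rw [if_pos]
    refine ⟨?_, (forall_mem_support_iff hT).2 fun c hc => ?_⟩
    · rw [Finset.card_eq_two]
      refine ⟨a, b, hne, Finset.ext fun c => ⟨fun hc => by simpa using hW c hc, fun hc => ?_⟩⟩
      rcases Finset.mem_insert.1 hc with rfl | hc
      · exact ha
      · rwa [Finset.mem_singleton.1 hc]
    · rw [G.dist_comm (u := c) (v := v)]
      rcases hW c hc with rfl | rfl <;> omega
  have hphi : phi G u v = 0 := by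
    rw [← level_of_mem_wcenters ha]
    refine phi_eq ((isAncestor_iff hT).2 ⟨a, ha, by simp⟩)
      ((isAncestor_iff hT).2 ⟨a, ha, by simp⟩) fun y hyu hyv => ?_
    by_cases hy : y ∈ wcenters G
    · rw [level_of_mem_wcenters hy]
      exact Nat.zero_le _
    · have := dist_add_two_mul_level_le hT hyu hyv hy
      omega
  rw [hphi, hdelta]
  omega

lemma sum_range_of_isInducedOrder {G : SimpleGraph V} {f : V → ℕ} {u : ℕ → V}
    (hord : IsInducedOrder G f u) (g : V → ℤ) :
    ∑ t ∈ Finset.range (Fintype.card V), g (u t) = ∑ v, g v := by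
  refine Finset.sum_bij (fun t _ => u t) (fun _ _ => Finset.mem_univ _) ?_ ?_ fun _ _ => rfl
  · intro i hi j hj hij
    exact (hord.1 (u i)).unique ⟨Finset.mem_range.1 hi, rfl⟩ ⟨Finset.mem_range.1 hj, hij.symm⟩
  · intro v _
    obtain ⟨i, ⟨hi, hv⟩, -⟩ := hord.1 v
    exact ⟨i, Finset.mem_range.2 hi, hv⟩

lemma span_eq_of_isInducedOrder [Nonempty V] {G : SimpleGraph V} {f : V → ℕ} {u : ℕ → V}
    (hord : IsInducedOrder G f u) :
    (span f : ℤ) = (f (u (Fintype.card V - 1)) : ℤ) - f (u 0) := by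
  have hpos : 0 < Fintype.card V := Fintype.card_pos
  have hmono : ∀ i j, i ≤ j → j < Fintype.card V → f (u i) ≤ f (u j) := by
    intro i j hij hj
    rcases hij.eq_or_lt with rfl | h
    · exact le_rfl
    · exact (hord.2 i j h hj).le
  have hle := hmono 0 (Fintype.card V - 1) (Nat.zero_le _) (by omega)
  have hs : span f = f (u (Fintype.card V - 1)) - f (u 0) := by
    refine le_antisymm (Finset.sup_le ?_) (Finset.le_sup
      (f := fun pr : V × V => f pr.1 - f pr.2) (Finset.mem_univ (u (Fintype.card V - 1), u 0)))
    rintro ⟨x, y⟩ -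
    obtain ⟨i, ⟨hi, rfl⟩, -⟩ := hord.1 x
    obtain ⟨j, ⟨hj, rfl⟩, -⟩ := hord.1 y
    have h1 := hmono i (Fintype.card V - 1) (by omega) (by omega)
    have h2 := hmono 0 j (Nat.zero_le _) hj
    simp only
    omega
  rw [hs, Nat.cast_sub hle]

lemma sum_range_add_succ (g : ℕ → ℤ) (n : ℕ) :
    ∑ t ∈ Finset.range n, (g t + g (t + 1)) =
      2 * ∑ t ∈ Finset.range (n + 1), g t - g 0 - g n := by
  rw [Finset.sum_add_distrib]
  linarith [Finset.sum_range_succ g n, Finset.sum_range_succ' g n]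

/-- **Equation (eqn:sumup).** For any tree `T` with diameter `d ≥ 2` and any radio
labelling `f` of `T`, `span(f) = (p-1)(d+1) - 2L(T) + L(u_0) + L(u_{p-1}) + σ(f)`. -/
theorem stmt17 {V : Type*} [Fintype V] [DecidableEq V] (G : SimpleGraph V)
    (hT : G.IsTree) (hd : 2 ≤ gdiam G)
    (f : V → ℕ) (hf : IsRadioLabelling G f)
    (u : ℕ → V) (hord : IsInducedOrder G f u) :
    (span f : ℤ) =
      ((Fintype.card V : ℤ) - 1) * ((gdiam G : ℤ) + 1) - 2 * (totalLevel G : ℤ)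
        + (level G (u 0) : ℤ) + (level G (u (Fintype.card V - 1)) : ℤ)
        + sigmaF G f u := by
  have := hT.connected.nonempty
  obtain ⟨n, hn⟩ : ∃ n, Fintype.card V = n + 1 :=
    ⟨Fintype.card V - 1, by have := Fintype.card_pos (α := V); omega⟩
  have hL := sum_range_of_isInducedOrder hord fun v => (level G v : ℤ)
  rw [span_eq_of_isInducedOrder hord]
  unfold sigmaF totalLevel
  rw [hn] at hL ⊢
  rw [Nat.add_sub_cancel, Nat.cast_sum, ← hL]
  have hterm : ∀ t, Jstep G f u t + 2 * (phi G (u t) (u (t + 1)) : ℤ)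
      - (deltaWC G (u t) (u (t + 1)) : ℤ) =
      ((f (u (t + 1)) : ℤ) - f (u t)) + ((level G (u t) : ℤ) + level G (u (t + 1)))
        - ((gdiam G : ℤ) + 1) := by
    intro t
    have h := dist_formula hT (u t) (u (t + 1))
    unfold Jstep
    zify at h
    linarith
  rw [Finset.sum_congr rfl fun t _ => hterm t, Finset.sum_sub_distrib, Finset.sum_add_distrib,
    Finset.sum_range_sub (fun t => (f (u t) : ℤ)),
    sum_range_add_succ (fun t => (level G (u t) : ℤ)), Finset.sum_const, Finset.card_range,
    nsmul_eq_mul]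
  push_cast
  ring

end RadioPaper
end

section
/- Let P_n be the path on n ≥ 4 vertices. If n = 2k+1 is odd, then rn(P_n) = 2k² + 2; if n = 2k is even, then rn(P_n) = 2k(k-1) + 1. -/
open SimpleGraph Finset

open scoped Classical

namespace RadioPaper

variable {V : Type*} [Fintype V] [DecidableEq V]

lemma abs_sub_le_length_of_walk_pathGraph {n : ℕ} {u v : Fin n}
    (p : (SimpleGraph.pathGraph n).Walk u v) :
    |(u : ℤ) - (v : ℤ)| ≤ p.length := by
  induction p with
  | nil => simp
  | cons h p ih =>
    rw [SimpleGraph.pathGraph_adj] at h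
    rw [SimpleGraph.Walk.length_cons]
    grind

lemma exists_walk_pathGraph {n : ℕ} (d : ℕ) : ∀ u v : Fin n, (u : ℕ) + d = v →
    ∃ p : (SimpleGraph.pathGraph n).Walk u v, p.length = d := by
  induction d with
  | zero =>
    intro u v h
    obtain rfl : u = v := Fin.ext (by simpa using h)
    exact ⟨.nil, rfl⟩
  | succ d ih =>
    intro u v h
    obtain ⟨p, hp⟩ := ih ⟨u + 1, by omega⟩ v (by simp only; omega)
    exact ⟨.cons (SimpleGraph.pathGraph_adj.2 (.inl rfl)) p, by simp [hp]⟩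

lemma dist_pathGraph {n : ℕ} (u v : Fin n) :
    ((SimpleGraph.pathGraph n).dist u v : ℤ) = |(u : ℤ) - (v : ℤ)| := by
  wlog huv : u ≤ v generalizing u v
  · rw [SimpleGraph.dist_comm, this v u (le_of_not_ge huv), abs_sub_comm]
  have huv' : (u : ℕ) ≤ v := huv
  obtain ⟨p, hp⟩ := exists_walk_pathGraph ((v : ℕ) - u) u v (by omega)
  obtain ⟨q, hq⟩ := p.reachable.exists_walk_length_eq_dist
  have h₁ := SimpleGraph.dist_le p
  have h₂ := abs_sub_le_length_of_walk_pathGraph q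
  grind

lemma gdiam_pathGraph (m : ℕ) : gdiam (SimpleGraph.pathGraph (m + 1)) = m := by
  apply le_antisymm
  · refine Finset.sup_le fun x _ => ?_
    have := dist_pathGraph x.1 x.2
    have := x.1.isLt
    have := x.2.isLt
    grind
  · have h := dist_pathGraph (0 : Fin (m + 1)) (Fin.last m)
    have h' : (SimpleGraph.pathGraph (m + 1)).dist 0 (Fin.last m) ≤ _ :=
      Finset.le_sup (f := fun x : Fin (m + 1) × Fin (m + 1) =>
        (SimpleGraph.pathGraph (m + 1)).dist x.1 x.2) (Finset.mem_univ (0, Fin.last m))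
    unfold gdiam
    simp only [Fin.val_zero, Fin.val_last] at h
    grind

lemma isRadioLabelling_pathGraph_iff {m : ℕ} {f : Fin (m + 1) → ℕ} :
    IsRadioLabelling (SimpleGraph.pathGraph (m + 1)) f ↔
      ∀ u v : Fin (m + 1), u ≠ v →
        (m : ℤ) + 1 - |(u : ℤ) - (v : ℤ)| ≤ |(f u : ℤ) - (f v : ℤ)| := by
  simp only [IsRadioLabelling, gdiam_pathGraph, dist_pathGraph]

lemma radioNumber_eq {V : Type*} [Fintype V] [DecidableEq V] {G : SimpleGraph V} {s : ℕ}
    (hlower : ∀ f : V → ℕ, IsRadioLabelling G f → s ≤ span f)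
    (hupper : ∃ f : V → ℕ, IsRadioLabelling G f ∧ ∀ v, f v ≤ s) : radioNumber G = s := by
  obtain ⟨f, hf, hs⟩ := hupper
  have hspan : span f = s :=
    le_antisymm (Finset.sup_le fun x _ => (Nat.sub_le _ _).trans (hs x.1)) (hlower f hf)
  apply le_antisymm
  · exact Nat.sInf_le ⟨f, hf, hspan⟩
  · refine le_csInf ⟨s, f, hf, hspan⟩ ?_
    rintro _ ⟨g, hg, rfl⟩
    exact hlower g hg

/-- Twice the distance from `i` to the midpoint of `{0, …, m}`. -/
def midDist (m i : ℕ) : ℤ := |2 * (i : ℤ) - m|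

lemma sum_midDist_add_two (m : ℕ) :
    ∑ i ∈ Finset.range (m + 2 + 1), midDist (m + 2) i =
      ∑ i ∈ Finset.range (m + 1), midDist m i + 2 * (m + 2) := by
  rw [Finset.sum_range_succ, Finset.sum_range_succ']
  have h : ∀ i ∈ Finset.range (m + 1), midDist (m + 2) (i + 1) = midDist m i := by
    intro i _
    unfold midDist
    congr 1
    push_cast
    ring
  rw [Finset.sum_congr rfl h]
  unfold midDist
  grind

lemma sum_midDist_even (k : ℕ) :
    ∑ i ∈ Finset.range (2 * k + 1), midDist (2 * k) i = 2 * k * (k + 1) := by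
  induction k with
  | zero => simp [midDist]
  | succ k ih =>
    rw [show 2 * (k + 1) = 2 * k + 2 by ring, sum_midDist_add_two, ih]
    push_cast
    ring

lemma sum_midDist_odd (k : ℕ) :
    ∑ i ∈ Finset.range (2 * k + 1 + 1), midDist (2 * k + 1) i = 2 * (k + 1) ^ 2 := by
  induction k with
  | zero => simp [midDist, Finset.sum_range_succ]
  | succ k ih =>
    rw [show 2 * (k + 1) + 1 = 2 * k + 1 + 2 by ring, sum_midDist_add_two, ih]
    push_cast
    ring

/-- Twice the amount by which the label gap between the `i`-th and `(i+1)`-st vertex of the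
order `σ` exceeds the gap that would be forced if the two vertices were separated by the
midpoint of the path. -/
def slack {m : ℕ} (f : Fin (m + 1) → ℕ) (σ : Equiv.Perm (Fin (m + 1))) (i : Fin m) : ℤ :=
  2 * ((f (σ i.succ) : ℤ) - f (σ i.castSucc)) - 2 * (m + 1)
    + midDist m (σ i.castSucc) + midDist m (σ i.succ)

lemma sum_slack {m : ℕ} (f : Fin (m + 1) → ℕ) (σ : Equiv.Perm (Fin (m + 1))) :
    ∑ i, slack f σ i + midDist m (σ 0) + midDist m (σ (Fin.last m)) =
      2 * ((f (σ (Fin.last m)) : ℤ) - f (σ 0)) - 2 * m * (m + 1)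
        + 2 * ∑ i ∈ Finset.range (m + 1), midDist m i := by
  have hL : ∑ i ∈ Finset.range (m + 1), midDist m i = ∑ i, midDist m (σ i) := by
    rw [Finset.sum_range, Equiv.sum_comp σ fun i => midDist m i]
  have h₁ := Fin.sum_univ_castSucc fun i => midDist m (σ i)
  have h₂ := Fin.sum_univ_succ fun i => midDist m (σ i)
  have h₃ := Fin.sum_univ_castSucc fun i => (f (σ i) : ℤ)
  have h₄ := Fin.sum_univ_succ fun i => (f (σ i) : ℤ)
  simp only [slack, Finset.sum_add_distrib, Finset.sum_sub_distrib, ← Finset.mul_sum,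
    Finset.sum_const, Finset.card_univ, Fintype.card_fin, nsmul_eq_mul]
  linarith

lemma le_sub_of_isRadioLabelling {m : ℕ} {f : Fin (m + 1) → ℕ}
    (hf : IsRadioLabelling (SimpleGraph.pathGraph (m + 1)) f) {i j : Fin (m + 1)} (hij : i < j) :
    (m : ℤ) + 1 - |(Tuple.sort f i : ℤ) - (Tuple.sort f j : ℤ)|
      ≤ (f (Tuple.sort f j) : ℤ) - f (Tuple.sort f i) := by
  have h := isRadioLabelling_pathGraph_iff.1 hf (Tuple.sort f i) (Tuple.sort f j)
    ((Tuple.sort f).injective.ne hij.ne)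
  have h' : f (Tuple.sort f i) ≤ f (Tuple.sort f j) := Tuple.monotone_sort f hij.le
  grind

lemma slack_nonneg {m : ℕ} {f : Fin (m + 1) → ℕ}
    (hf : IsRadioLabelling (SimpleGraph.pathGraph (m + 1)) f) (i : Fin m) :
    0 ≤ slack f (Tuple.sort f) i := by
  have h := le_sub_of_isRadioLabelling hf (Fin.castSucc_lt_succ (i := i))
  unfold slack midDist
  grind

lemma sub_le_span {V : Type*} [Fintype V] (f : V → ℕ) (u v : V) :
    (f u : ℤ) - f v ≤ span f := by
  have h : f u - f v ≤ span f :=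
    Finset.le_sup (f := fun x : V × V => f x.1 - f x.2) (Finset.mem_univ (u, v))
  omega

lemma le_span_pathGraph_even (k : ℕ) (f : Fin (2 * k + 1 + 1) → ℕ)
    (hf : IsRadioLabelling (SimpleGraph.pathGraph (2 * k + 1 + 1)) f) :
    2 * (k + 1) * k + 1 ≤ span f := by
  have h := sum_slack f (Tuple.sort f)
  rw [sum_midDist_odd] at h
  have h₀ : 0 ≤ ∑ i, slack f (Tuple.sort f) i := Finset.sum_nonneg fun i _ => slack_nonneg hf i
  have hs := sub_le_span f (Tuple.sort f (Fin.last _)) (Tuple.sort f 0)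
  have h₁ : ∀ i, 1 ≤ midDist (2 * k + 1) i := by
    intro i
    unfold midDist
    grind
  have h₂ := h₁ (Tuple.sort f 0)
  have h₃ := h₁ (Tuple.sort f (Fin.last _))
  zify
  push_cast at h
  nlinarith

lemma eq_midpoint_of_slack_eq_zero {k : ℕ} {f : Fin (2 * k + 1) → ℕ}
    (hf : IsRadioLabelling (SimpleGraph.pathGraph (2 * k + 1)) f)
    (hslack : ∀ i, slack f (Tuple.sort f) i = 0) {t : ℕ} (ht : t + 2 < 2 * k + 1)
    (hend : midDist (2 * k) (Tuple.sort f ⟨t + 1, by omega⟩) = 2 * k) :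
    (Tuple.sort f ⟨t, by omega⟩ : ℕ) = k ∨ (Tuple.sort f ⟨t + 2, ht⟩ : ℕ) = k := by
  have e₁ := hslack ⟨t, by omega⟩
  have e₂ := hslack ⟨t + 1, by omega⟩
  have g₁ := le_sub_of_isRadioLabelling hf
    (i := ⟨t, by omega⟩) (j := ⟨t + 1, by omega⟩) (by simp)
  have g₂ := le_sub_of_isRadioLabelling hf
    (i := ⟨t + 1, by omega⟩) (j := ⟨t + 2, ht⟩) (by simp)
  have g₃ := le_sub_of_isRadioLabelling hf
    (i := ⟨t, by omega⟩) (j := ⟨t + 2, ht⟩) (by simp)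
  simp only [slack, Fin.castSucc_mk, Fin.succ_mk, add_assoc, Nat.reduceAdd] at e₁ e₂
  have hb₀ := (Tuple.sort f ⟨t, by omega⟩).isLt
  have hb₂ := (Tuple.sort f ⟨t + 2, ht⟩).isLt
  generalize Tuple.sort f ⟨t, by omega⟩ = a at *
  generalize Tuple.sort f ⟨t + 1, by omega⟩ = r at *
  generalize Tuple.sort f ⟨t + 2, ht⟩ = b at *
  unfold midDist at *
  push_cast at *
  grind

lemma le_span_pathGraph_odd {k : ℕ} (hk : 2 ≤ k) (f : Fin (2 * k + 1) → ℕ)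
    (hf : IsRadioLabelling (SimpleGraph.pathGraph (2 * k + 1)) f) :
    2 * k ^ 2 + 2 ≤ span f := by
  by_contra! hlt
  set σ := Tuple.sort f with hσ
  have h := sum_slack f σ
  rw [sum_midDist_even] at h
  have hs := sub_le_span f (σ (Fin.last _)) (σ 0)
  have hle : ∀ i, slack f σ i ≤ ∑ i, slack f σ i := fun i =>
    Finset.single_le_sum (fun j _ => slack_nonneg hf j) (Finset.mem_univ i)
  have h₀ : 0 ≤ ∑ i, slack f σ i := Finset.sum_nonneg fun i _ => slack_nonneg hf i
  have htot : ∑ i, slack f σ i + midDist (2 * k) (σ 0) + midDist (2 * k) (σ (Fin.last _)) ≤ 2 := by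
    zify at hlt
    push_cast at h
    nlinarith
  have hne : (σ 0 : ℕ) ≠ σ (Fin.last (2 * k)) := fun he => by
    have := congrArg Fin.val (σ.injective (Fin.ext he))
    simp at this
    omega
  have hslack : ∀ i, slack f σ i = 0 := by
    intro i
    have h₁ := hle i
    have h₂ := slack_nonneg hf i
    rw [← hσ] at h₂
    unfold midDist at htot
    push_cast at htot
    grind
  have hsum : midDist (2 * k) (σ 0) + midDist (2 * k) (σ (Fin.last _)) ≤ 2 := by linarith
  have key : ∀ r : Fin (2 * k + 1), midDist (2 * k) r = 2 * k →
      (((σ 0 : ℕ) = k → (σ.symm r : ℕ) = 1) ∧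
        ((σ 0 : ℕ) ≠ k → (σ.symm r : ℕ) + 1 = 2 * k)) := by
    intro r hr
    obtain ⟨p, rfl⟩ := σ.surjective r
    rw [σ.symm_apply_apply]
    have hp₀ : p ≠ 0 := by
      rintro rfl
      unfold midDist at *
      grind
    have hp₁ : p ≠ Fin.last _ := by
      rintro rfl
      unfold midDist at *
      grind
    obtain ⟨p, hp⟩ := p
    obtain ⟨t, rfl⟩ : ∃ t, p = t + 1 := Nat.exists_eq_succ_of_ne_zero fun h => hp₀ (Fin.ext h)
    have ht : t + 1 ≠ 2 * k := fun h => hp₁ (Fin.ext h)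
    have hmid : ∀ i : Fin (2 * k + 1), (σ i : ℕ) = k →
        ((σ 0 : ℕ) = k → (i : ℕ) = 0) ∧ ((σ 0 : ℕ) ≠ k → (i : ℕ) = 2 * k) := by
      intro i hi
      refine ⟨fun h0 => ?_, fun h0 => ?_⟩
      · rw [σ.injective (Fin.ext (hi.trans h0.symm))]
        rfl
      · have : (σ (Fin.last (2 * k)) : ℕ) = k := by
          unfold midDist at hsum
          push_cast at hsum
          grind
        rw [σ.injective (Fin.ext (hi.trans this.symm))]
        rfl
    rcases eq_midpoint_of_slack_eq_zero hf hslack (t := t) (by omega) hr with h | h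
    · have := hmid _ h
      simp only at this ⊢
      omega
    · have := hmid _ h
      simp only at this ⊢
      omega
  have k₁ := key 0 (by simp [midDist])
  have k₂ := key (Fin.last _) (by
    simp only [midDist, Fin.val_last]
    push_cast
    grind)
  have : (σ.symm 0 : ℕ) = σ.symm (Fin.last (2 * k)) := by omega
  have := congrArg Fin.val (σ.symm.injective (Fin.ext this))
  simp at this
  omega

lemma isRadioLabelling_pathGraph_of_lt {m : ℕ} {f : ℕ → ℕ}
    (h : ∀ u v : ℕ, u < v → v ≤ m → (m : ℤ) + 1 - (v - u) ≤ |(f v : ℤ) - f u|) :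
    IsRadioLabelling (SimpleGraph.pathGraph (m + 1)) fun i => f i := by
  rw [isRadioLabelling_pathGraph_iff]
  intro u v huv
  rcases lt_or_gt_of_ne (Fin.val_ne_of_ne huv) with hlt | hlt
  · rw [abs_sub_comm, abs_of_pos (by omega), abs_sub_comm]
    exact h u v hlt (by omega)
  · rw [abs_of_pos (by omega)]
    exact h v u hlt (by omega)

lemma exists_isRadioLabelling_pathGraph_even (k : ℕ) :
    ∃ f : Fin (2 * k + 1 + 1) → ℕ,
      IsRadioLabelling (SimpleGraph.pathGraph (2 * k + 1 + 1)) f ∧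
        ∀ v, f v ≤ 2 * (k + 1) * k + 1 := by
  let f : ℕ → ℕ := fun i => if i ≤ k then (k - i) * (2 * k + 1)
    else (2 * k + 1 - i) * (2 * k + 1) + k + 1
  have hleft : ∀ i, i ≤ k → (f i : ℤ) = (k - i) * (2 * k + 1) := by
    intro i hi
    simp [f, hi]
  have hright : ∀ i, k < i → i ≤ 2 * k + 1 →
      (f i : ℤ) = (2 * k + 1 - i) * (2 * k + 1) + k + 1 := by
    intro i hi hi'
    simp [f, hi.not_ge, hi']
  refine ⟨fun i => f i, isRadioLabelling_pathGraph_of_lt fun u v huv hv => ?_, fun v => ?_⟩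
  · push_cast
    rcases le_or_gt v k with hvk | hvk
    · rw [hleft u (by omega), hleft v hvk, le_abs]
      right
      nlinarith
    rw [hright v hvk hv]
    rcases le_or_gt u k with huk | huk
    · rw [hleft u huk, le_abs]
      rcases le_or_gt (v : ℤ) (k + 1 + u) with h | h
      · left
        nlinarith
      · right
        nlinarith
    · rw [hright u huk (by omega), le_abs]
      right
      nlinarith
  · have := v.isLt
    zify
    rcases le_or_gt (v : ℕ) k with hvk | hvk
    · rw [hleft v hvk]
      nlinarith
    · rw [hright v hvk (by omega)]
      nlinarith

lemma exists_isRadioLabelling_pathGraph_odd {k : ℕ} (hk : 2 ≤ k) :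
    ∃ f : Fin (2 * k + 1) → ℕ,
      IsRadioLabelling (SimpleGraph.pathGraph (2 * k + 1)) f ∧
        ∀ v, f v ≤ 2 * k ^ 2 + 2 := by
  let f : ℕ → ℕ := fun i => if i < k then (2 * k + 1) * i + k + 3
    else if i = k then 0
    else if i = 2 * k then k + 1 else (2 * k + 1) * (i - k) + 2
  have hleft : ∀ i, i < k → (f i : ℤ) = (2 * k + 1) * i + k + 3 := by
    intro i hi
    simp [f, hi]
  have hmid : (f k : ℤ) = 0 := by simp [f]
  have hlast : (f (2 * k) : ℤ) = k + 1 := by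
    simp [f, show ¬ 2 * k < k by omega, show 2 * k ≠ k by omega]
  have hright : ∀ i, k < i → i < 2 * k → (f i : ℤ) = (2 * k + 1) * (i - k) + 2 := by
    intro i hi hi'
    simp [f, hi.not_gt, hi.ne', hi'.ne, hi.le]
  refine ⟨fun i => f i, isRadioLabelling_pathGraph_of_lt fun u v huv hv => ?_, fun v => ?_⟩
  · push_cast
    rcases lt_trichotomy v k with hvk | rfl | hvk
    · rw [hleft u (by omega), hleft v hvk, le_abs]
      left
      nlinarith
    · rw [hleft u huv, hmid, le_abs]
      right
      nlinarith
    rcases hv.lt_or_eq with hv' | rfl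
    · rw [hright v hvk hv']
      rcases lt_trichotomy u k with huk | rfl | huk
      · rw [hleft u huk, le_abs]
        rcases le_or_gt (v : ℤ) (k + u) with h | h
        · right
          nlinarith
        · left
          nlinarith
      · rw [hmid, le_abs]
        left
        nlinarith
      · rw [hright u huk (by omega), le_abs]
        left
        nlinarith
    · rw [hlast]
      rcases lt_trichotomy u k with huk | rfl | huk
      · rw [hleft u huk, le_abs]
        right
        push_cast
        nlinarith
      · rw [hmid, le_abs]
        left
        push_cast
        linarith
      · rw [hright u huk huv, le_abs]
        right
        push_cast
        nlinarith
  · obtain ⟨v, hv⟩ := v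
    simp only
    zify
    rcases lt_trichotomy v k with hvk | rfl | hvk
    · rw [hleft v hvk]
      nlinarith
    · rw [hmid]
      positivity
    rcases (Nat.le_of_lt_succ hv).lt_or_eq with hv' | rfl
    · rw [hright v hvk hv']
      nlinarith
    · rw [hlast]
      nlinarith

/-- **Theorem (Liu–Zhu).** The radio number of the path `P_n`, `n ≥ 4`. -/
theorem stmt19 (n : ℕ) (hn : 4 ≤ n) :
    (∀ k : ℕ, n = 2 * k + 1 →
      radioNumber (SimpleGraph.pathGraph n) = 2 * k ^ 2 + 2) ∧
    (∀ k : ℕ, n = 2 * k →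
      radioNumber (SimpleGraph.pathGraph n) = 2 * k * (k - 1) + 1) := by
  refine ⟨?_, ?_⟩
  · rintro k rfl
    exact radioNumber_eq (le_span_pathGraph_odd (by omega))
      (exists_isRadioLabelling_pathGraph_odd (by omega))
  · rintro k rfl
    obtain ⟨k, rfl⟩ : ∃ l, k = l + 1 := Nat.exists_eq_add_of_le' (by omega)
    exact radioNumber_eq (le_span_pathGraph_even k) (exists_isRadioLabelling_pathGraph_even k)

end RadioPaper
end
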